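/- For every real x > 0, the derivative of the Hurwitz zeta function with respect to s at s = 0 satisfies ∂_s ζ(s,x)|_{s=0} = log Γ(x) − (1/2) log(2π) (Lerch's identity). -/

import Mathlib

open Filter Topology

/-- trapezoid-rule error of `t ↦ t ^ (-s)` on `[a, a+1]` -/
noncomputable def lerchG (a : ℝ) (s : ℂ) : ℂ :=
  ((a : ℂ) ^ (-s) + ((a + 1 : ℝ) : ℂ) ^ (-s)) / 2
    - (((a + 1 : ℝ) : ℂ) ^ (1 - s) - (a : ℂ) ^ (1 - s)) / (1 - s)

lemma lerch_hasDerivAt_cpow (a : ℝ) (ha : 0 < a) (c : ℂ) (u : ℝ) (hu : 0 ≤ u) :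
    HasDerivAt (fun u : ℝ => ((a + u : ℝ) : ℂ) ^ c) (c * ((a + u : ℝ) : ℂ) ^ (c - 1)) u := by
  have h1 : HasDerivAt (fun z : ℂ => (a : ℂ) + z) 1 (u : ℂ) := (hasDerivAt_id (u : ℂ)).const_add _
  have hm : (a : ℂ) + u ∈ Complex.slitPlane := by
    rw [← Complex.ofReal_add, Complex.ofReal_mem_slitPlane]
    linarith
  have h2 := (h1.cpow_const (c := c) hm).comp_ofReal
  simpa using h2

lemma lerchG_bound (a : ℝ) (ha : 0 < a) (s : ℂ) (hs1 : s ≠ 1) (hre : -1/2 < s.re)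
    (hn : ‖s‖ < 10) :
    ‖lerchG a s‖ ≤ 110 * (1 / |a| ^ (3/2 : ℝ) + 1 / |a| ^ (12 : ℝ)) := by
  set M : ℝ := 110 * (1 / |a| ^ (3/2 : ℝ) + 1 / |a| ^ (12 : ℝ)) with hM
  have hM0 : 0 ≤ M := by positivity
  have hs1' : 1 - s ≠ 0 := sub_ne_zero.mpr hs1.symm
  have hre2 : s.re < 10 := lt_of_le_of_lt (Complex.re_le_norm s) hn
  -- second derivative bound
  have hb2 : ∀ u ∈ Set.Icc (0:ℝ) 1,
      ‖(u / 2 : ℂ) * (-s * ((-s - 1) * ((a + u : ℝ) : ℂ) ^ (-s - 1 - 1)))‖ ≤ M := by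
    intro u hu
    have hau : 0 < a + u := by linarith [hu.1]
    rw [norm_mul, norm_mul, norm_mul, Complex.norm_cpow_eq_rpow_re_of_pos hau]
    have e1 : ‖(u / 2 : ℂ)‖ ≤ 1 := by
      rw [norm_div, Complex.norm_real, Real.norm_of_nonneg hu.1]
      simp; linarith [hu.2]
    have e2 : ‖-s‖ ≤ 10 := by rw [norm_neg]; exact hn.le
    have e3 : ‖-s - 1‖ ≤ 11 := by
      refine (norm_sub_le _ _).trans ?_
      rw [norm_one]; linarith
    have e4 : (a + u) ^ (-s - 1 - 1).re ≤ 1 / |a| ^ (3/2 : ℝ) + 1 / |a| ^ (12 : ℝ) := by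
      rw [abs_of_pos ha, one_div, one_div, ← Real.rpow_neg ha.le, ← Real.rpow_neg ha.le]
      have hr : (-s - 1 - 1).re = -s.re - 2 := by simp; ring
      rw [hr]
      refine (Real.rpow_le_rpow_of_nonpos ha (by linarith [hu.1]) (by linarith)).trans ?_
      have p1 : 0 < a ^ (-(3/2) : ℝ) := by positivity
      have p2 : 0 < a ^ (-12 : ℝ) := by positivity
      rcases le_total 1 a with h | h
      · have := Real.rpow_le_rpow_of_exponent_le h (show -s.re - 2 ≤ -(3/2) by linarith)
        linarith
      · have := Real.rpow_le_rpow_of_exponent_ge ha h (show -12 ≤ -s.re - 2 by linarith)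
        linarith
    have p : 0 ≤ (a + u) ^ (-s - 1 - 1).re := by positivity
    calc _ ≤ 1 * (10 * (11 * (1 / |a| ^ (3/2 : ℝ) + 1 / |a| ^ (12 : ℝ)))) := by gcongr
      _ = M := by rw [hM]; ring
  let G : ℝ → ℂ := fun u => ((a:ℂ) ^ (-s) - ((a + u : ℝ) : ℂ) ^ (-s)) / 2
      + (u / 2 : ℂ) * (-s * ((a + u : ℝ) : ℂ) ^ (-s - 1))
  have hu2 : ∀ u : ℝ, HasDerivAt (fun u : ℝ => (u / 2 : ℂ)) (1/2) u := by
    intro u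
    simpa using ((hasDerivAt_id u).ofReal_comp.div_const 2)
  have hG : ∀ u ∈ Set.Icc (0:ℝ) 1, HasDerivAt G
      ((u / 2 : ℂ) * (-s * ((-s - 1) * ((a + u : ℝ) : ℂ) ^ (-s - 1 - 1)))) u := by
    intro u hu
    have h1 := ((lerch_hasDerivAt_cpow a ha (-s) u hu.1).const_sub ((a:ℂ) ^ (-s))).div_const 2
    have h2 := (hu2 u).mul ((lerch_hasDerivAt_cpow a ha (-s - 1) u hu.1).const_mul (-s))
    refine (h1.add h2).congr_deriv ?_
    ring
  have hGb : ∀ u ∈ Set.Icc (0:ℝ) 1, ‖G u‖ ≤ M := by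
    intro u hu
    have := norm_image_sub_le_of_norm_deriv_le_segment' (f := G)
      (fun x hx => (hG x hx).hasDerivWithinAt) (fun x hx => hb2 x ⟨hx.1, hx.2.le⟩) u hu
    have h0 : G 0 = 0 := by simp [G]
    rw [h0, sub_zero, sub_zero] at this
    nlinarith [hu.2]
  let F : ℝ → ℂ := fun u => (u / 2 : ℂ) * ((a:ℂ) ^ (-s) + ((a + u : ℝ) : ℂ) ^ (-s))
      - (((a + u : ℝ) : ℂ) ^ (1 - s) - (a : ℂ) ^ (1 - s)) / (1 - s)
  have hF : ∀ u ∈ Set.Icc (0:ℝ) 1, HasDerivAt F (G u) u := by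
    intro u hu
    have h1 := (hu2 u).mul ((lerch_hasDerivAt_cpow a ha (-s) u hu.1).const_add ((a:ℂ) ^ (-s)))
    have h2 := ((lerch_hasDerivAt_cpow a ha (1-s) u hu.1).sub_const
      ((a:ℂ) ^ (1-s))).div_const (1 - s)
    refine (h1.sub h2).congr_deriv ?_
    rw [show (1 - s - 1) = -s by ring, mul_div_cancel_left₀ _ hs1']
    simp only [G]
    ring
  have := norm_image_sub_le_of_norm_deriv_le_segment_01' (f := F)
      (fun x hx => (hF x hx).hasDerivWithinAt) (fun x hx => hGb x ⟨hx.1, hx.2.le⟩)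
  have h0 : F 0 = 0 := by simp [F]
  have h1 : F 1 = lerchG a s := by simp [F, lerchG]; ring
  rwa [h0, sub_zero, h1] at this

lemma lerch_hasDerivAt_base (a : ℝ) (ha : 0 < a) (s : ℂ) :
    HasDerivAt (fun s : ℂ => (a:ℂ) ^ (-s)) (-((a:ℂ) ^ (-s) * Real.log a)) s := by
  have := (hasDerivAt_id s).neg.const_cpow (c := (a:ℂ)) (Or.inl (by exact_mod_cast ha.ne'))
  rw [← Complex.ofReal_log ha.le] at this
  simpa using this

lemma lerch_hasDerivAt_base' (a : ℝ) (ha : 0 < a) (s : ℂ) (hs : s ≠ 1) :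
    HasDerivAt (fun s : ℂ => (a:ℂ) ^ (1-s) / (1 - s))
      ((-((a:ℂ) ^ (1-s) * Real.log a) * (1 - s) + (a:ℂ) ^ (1-s)) / (1-s)^2) s := by
  have h1 := ((hasDerivAt_id s).const_sub 1)
  have := h1.const_cpow (c := (a:ℂ)) (Or.inl (by exact_mod_cast ha.ne'))
  rw [← Complex.ofReal_log ha.le] at this
  have h3 := this.div h1 (sub_ne_zero.mpr hs.symm)
  refine h3.congr_deriv ?_
  simp

lemma lerchG_eq (a : ℝ) (s : ℂ) : lerchG a s = ((a : ℂ) ^ (-s) + ((a + 1 : ℝ) : ℂ) ^ (-s)) / 2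
    - (((a + 1 : ℝ) : ℂ) ^ (1 - s) / (1 - s) - (a : ℂ) ^ (1 - s) / (1 - s)) := by
  rw [lerchG, sub_div]

lemma lerchG_diff (a : ℝ) (ha : 0 < a) (s : ℂ) (hs : s ≠ 1) : DifferentiableAt ℂ (lerchG a) s := by
  have ha' : 0 < a + 1 := by linarith
  rw [funext (lerchG_eq a)]
  exact ((((lerch_hasDerivAt_base a ha s).add (lerch_hasDerivAt_base _ ha' s)).div_const 2).sub
    ((lerch_hasDerivAt_base' _ ha' s hs).sub
      (lerch_hasDerivAt_base' a ha s hs))).differentiableAt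

lemma lerchG_deriv (a : ℝ) (ha : 0 < a) : deriv (lerchG a) 0 =
    ((-(Real.log a + Real.log (a+1))/2 +
      (((a+1) * Real.log (a+1) - (a+1)) - (a * Real.log a - a)) : ℝ) : ℂ) := by
  have ha' : 0 < a + 1 := by linarith
  rw [funext (lerchG_eq a)]
  have h := ((((lerch_hasDerivAt_base a ha 0).add (lerch_hasDerivAt_base _ ha' 0)).div_const 2).sub
    ((lerch_hasDerivAt_base' _ ha' 0 zero_ne_one).sub
      (lerch_hasDerivAt_base' a ha 0 zero_ne_one))).deriv
  refine h.trans ?_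
  simp
  ring

lemma lerch_sum_deriv (x : ℝ) (hx : 0 < x) (N : ℕ) :
    ∑ n ∈ Finset.range N, (-(Real.log (n+x) + Real.log ((n+x)+1))/2 +
      ((((n+x)+1) * Real.log ((n+x)+1) - ((n+x)+1)) - ((n+x) * Real.log (n+x) - (n+x)))) =
    -∑ n ∈ Finset.range N, Real.log (x + n) - (Real.log (N + x) - Real.log x)/2
      + ((N+x) * Real.log (N+x) - (N+x)) - (x * Real.log x - x) := by
  induction N with
  | zero => simp
  | succ N ih =>
    rw [Finset.sum_range_succ, ih, Finset.sum_range_succ]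
    push_cast
    rw [show (N:ℝ) + 1 + x = N + x + 1 by ring, show x + (N:ℝ) = N + x by ring]
    ring

lemma lerch_limit (x : ℝ) (hx : 0 < x) :
    Tendsto (fun N : ℕ => -∑ n ∈ Finset.range N, Real.log (x + n) - (Real.log (N + x))/2
      + ((N+x) * Real.log (N+x) - (N+x))) atTop
      (𝓝 (Real.log (Real.Gamma x) - (1 / 2) * Real.log (2 * Real.pi))) := by
  rw [← tendsto_add_atTop_iff_nat 1]
  have t1 : Tendsto (fun N : ℕ => Real.log (Real.GammaSeq x N)) atTop
      (𝓝 (Real.log (Real.Gamma x))) :=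
    (Real.GammaSeq_tendsto_Gamma x).log (Real.Gamma_pos_of_pos hx).ne'
  have t2 : Tendsto (fun N : ℕ => Real.log (Stirling.stirlingSeq N)) atTop
      (𝓝 (Real.log (√Real.pi))) :=
    Stirling.tendsto_stirlingSeq_sqrt_pi.log (by positivity)
  have t3 : Tendsto (fun N : ℕ => (N:ℝ) * Real.log (1 + (1 + x) / N)) atTop (𝓝 (1 + x)) :=
    (Real.tendsto_mul_log_one_add_div_atTop (1 + x)).comp tendsto_natCast_atTop_atTop
  have t4 : Tendsto (fun N : ℕ => Real.log (1 + (1 + x) / N)) atTop (𝓝 0) := by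
    have : Tendsto (fun N : ℕ => 1 + (1 + x) / (N:ℝ)) atTop (𝓝 (1 + 0)) :=
      tendsto_const_nhds.add (tendsto_const_div_atTop_nhds_zero_nat _)
    simpa using this.log (by norm_num)
  have key := ((t1.sub t2).add ((t3.add (t4.const_mul (x + 1/2))).sub_const (1 + x))).sub_const
    (Real.log 2 / 2)
  have hlim : Real.log (Real.Gamma x) - Real.log √Real.pi + (1 + x + (x + 1/2) * 0 - (1 + x))
      - Real.log 2 / 2 = Real.log (Real.Gamma x) - (1 / 2) * Real.log (2 * Real.pi) := by
    rw [Real.log_sqrt Real.pi_pos.le, Real.log_mul two_ne_zero Real.pi_ne_zero]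
    ring
  rw [hlim] at key
  refine key.congr' ?_
  filter_upwards [eventually_gt_atTop 0] with N hN
  have hN' : (0:ℝ) < N := by exact_mod_cast hN
  have hp : ∀ j ∈ Finset.range (N+1), x + (j:ℝ) ≠ 0 := fun j _ => by positivity
  have hf : (N.factorial : ℝ) ≠ 0 := by exact_mod_cast N.factorial_ne_zero
  have hr : (N:ℝ) ^ x ≠ 0 := by positivity
  rw [Stirling.log_stirlingSeq_formula, Real.GammaSeq, Real.log_div (mul_ne_zero hr hf)
    (Finset.prod_ne_zero_iff.mpr hp), Real.log_mul hr hf, Real.log_prod hp, Real.log_rpow hN',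
    Real.log_div hN'.ne' (Real.exp_ne_zero _), Real.log_exp, Real.log_mul two_ne_zero hN'.ne',
    show 1 + (1 + x) / (N:ℝ) = (N + 1 + x) / N by field_simp; ring,
    Real.log_div (by positivity) hN'.ne']
  push_cast
  ring

lemma lerchG_hasSum (x : ℝ) (hx : 0 < x) (s : ℂ) (hs : 1 < s.re) (hn : ‖s‖ < 10) (z : ℂ)
    (hz : HasSum (fun n : ℕ => 1 / ((n : ℂ) + (x : ℂ)) ^ s) z) (u : ℕ → ℝ) (hu : Summable u)
    (hb : ∀ n : ℕ, ‖lerchG (n + x) s‖ ≤ u n) :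
    ∑' n : ℕ, lerchG (n + x) s = z - (x:ℂ) ^ (-s) / 2 + (x:ℂ) ^ (1 - s) / (1 - s) := by
  have hsum : Summable (fun n : ℕ => lerchG (n + x) s) := Summable.of_norm_bounded hu hb
  have hpart : ∀ N : ℕ, ∑ n ∈ Finset.range N, lerchG (n + x) s =
      ∑ n ∈ Finset.range N, 1 / ((n : ℂ) + (x : ℂ)) ^ s
       + (((N + x : ℝ) : ℂ) ^ (-s) - (x:ℂ) ^ (-s)) / 2
       - (((N + x : ℝ) : ℂ) ^ (1-s) / (1 - s) - (x:ℂ) ^ (1-s) / (1 - s)) := by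
    intro N
    induction N with
    | zero => simp
    | succ N ih =>
      rw [Finset.sum_range_succ, ih, Finset.sum_range_succ, lerchG_eq]
      have e : (((N + 1 : ℕ) : ℝ) + x) = N + x + 1 := by push_cast; ring
      rw [e, one_div, ← Complex.cpow_neg]
      push_cast
      ring
  have hz1 : ∀ c : ℂ, c.re < 0 →
      Tendsto (fun N : ℕ => ((N + x : ℝ) : ℂ) ^ c) atTop (𝓝 0) := by
    intro c hc
    rw [tendsto_zero_iff_norm_tendsto_zero]
    have h1 : Tendsto (fun N : ℕ => (N + x : ℝ)) atTop atTop :=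
      tendsto_atTop_add_const_right _ _ tendsto_natCast_atTop_atTop
    have h2 := (tendsto_rpow_neg_atTop (show 0 < -c.re by linarith)).comp h1
    refine h2.congr fun N => ?_
    have : (0:ℝ) < N + x := by positivity
    rw [Complex.norm_cpow_eq_rpow_re_of_pos this]
    simp
  have T := (hz.tendsto_sum_nat.add (((hz1 (-s) (by simp; linarith)).sub_const
      ((x:ℂ) ^ (-s))).div_const 2)).sub
      (((hz1 (1-s) (by simp; linarith)).div_const (1 - s)).sub_const ((x:ℂ) ^ (1-s) / (1 - s)))
  have T2 := hsum.hasSum.tendsto_sum_nat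
  have := tendsto_nhds_unique T2 (T.congr fun N => (hpart N).symm)
  rw [this]
  ring

theorem lerch_identity (Z : ℝ → ℂ → ℂ)
    (hser : ∀ (x : ℝ), 0 < x → ∀ s : ℂ, 1 < s.re →
      HasSum (fun n : ℕ => 1 / ((n : ℂ) + (x : ℂ)) ^ s) (Z x s))
    (hdiff : ∀ (x : ℝ), 0 < x → ∀ s : ℂ, s ≠ 1 → DifferentiableAt ℂ (Z x) s)
    (x : ℝ) (hx : 0 < x) :
    deriv (Z x) 0 =
      ((Real.log (Real.Gamma x) - (1 / 2) * Real.log (2 * Real.pi) : ℝ) : ℂ) := by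
  let V : Set ℂ := Metric.ball 0 10 ∩ {s | -1/2 < s.re}
  let U1 : Set ℂ := V ∩ {s | 1 < s.re}
  let U2 : Set ℂ := V ∩ {s | 0 < s.im}
  let U3 : Set ℂ := V ∩ {s | s.re < 1}
  let U : Set ℂ := U1 ∪ U2 ∪ U3
  have hVc : Convex ℝ V := (convex_ball 0 10).inter (convex_halfSpace_re_gt _)
  have hVo : IsOpen V := Metric.isOpen_ball.inter (isOpen_lt continuous_const Complex.continuous_re)
  have hUo : IsOpen U :=
    ((hVo.inter (isOpen_lt continuous_const Complex.continuous_re)).union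
      (hVo.inter (isOpen_lt continuous_const Complex.continuous_im))).union
      (hVo.inter (isOpen_lt Complex.continuous_re continuous_const))
  have mem : ∀ a b : ℝ, 0 ≤ a → a ≤ 2 → 0 ≤ b → b ≤ 2 → (⟨a, b⟩ : ℂ) ∈ V := by
    intro a b h1 h2 h3 h4
    refine ⟨?_, ?_⟩
    · rw [mem_ball_zero_iff]
      refine (Complex.norm_le_abs_re_add_abs_im _).trans_lt ?_
      simp only [abs_of_nonneg h1, abs_of_nonneg h3]
      linarith
    · change -1 / 2 < a; linarith
  have hUp : IsPreconnected U := by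
    refine IsPreconnected.union (⟨0, 1⟩ : ℂ) (Or.inr ⟨mem 0 1 ?_ ?_ ?_ ?_, ?_⟩)
      ⟨mem 0 1 ?_ ?_ ?_ ?_, ?_⟩ (IsPreconnected.union (⟨2, 1⟩ : ℂ) ⟨mem 2 1 ?_ ?_ ?_ ?_, ?_⟩
        ⟨mem 2 1 ?_ ?_ ?_ ?_, ?_⟩ ?_ ?_) ?_
    all_goals first
      | exact (hVc.inter (convex_halfSpace_re_gt _)).isPreconnected
      | exact (hVc.inter (convex_halfSpace_im_gt _)).isPreconnected
      | exact (hVc.inter (convex_halfSpace_re_lt _)).isPreconnected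
      | (simp; done)
      | norm_num
  have hU : ∀ s ∈ U, s ≠ 1 ∧ -1/2 < s.re ∧ ‖s‖ < 10 := by
    rintro s ((⟨⟨h1, h2⟩, h3⟩ | ⟨⟨h1, h2⟩, h3⟩) | ⟨⟨h1, h2⟩, h3⟩)
    all_goals
      refine ⟨?_, h2, mem_ball_zero_iff.mp h1⟩
      rintro rfl
      simp at h3
  have h0 : (0:ℂ) ∈ U := Or.inr ⟨mem 0 0 le_rfl (by norm_num) le_rfl (by norm_num), by simp⟩
  have h2 : (2:ℂ) ∈ U :=
    Or.inl (Or.inl ⟨mem 2 0 (by norm_num) le_rfl le_rfl (by norm_num), by simp⟩)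
  let u : ℕ → ℝ := fun n => 110 * (1 / |(n + x : ℝ)| ^ (3/2 : ℝ) + 1 / |(n + x : ℝ)| ^ (12 : ℝ))
  have hu : Summable u :=
    (((Real.summable_one_div_nat_add_rpow x (3/2)).mpr (by norm_num)).add
      ((Real.summable_one_div_nat_add_rpow x 12).mpr (by norm_num))).mul_left 110
  have hpos : ∀ n : ℕ, (0:ℝ) < n + x := fun n => by positivity
  have hb : ∀ (n : ℕ) (s : ℂ), s ∈ U → ‖lerchG (n + x) s‖ ≤ u n := fun n s hs =>
    lerchG_bound _ (hpos n) s (hU s hs).1 (hU s hs).2.1 (hU s hs).2.2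
  have hd : ∀ n : ℕ, DifferentiableOn ℂ (lerchG (n + x)) U := fun n s hs =>
    (lerchG_diff _ (hpos n) s (hU s hs).1).differentiableWithinAt
  have hS := Complex.differentiableOn_tsum_of_summable_norm hu hd hUo hb
  have hD := Complex.hasSum_deriv_of_summable_norm hu hd hUo hb h0
  let R : ℂ → ℂ := fun s => Z x s - (x:ℂ) ^ (-s) / 2 + (x:ℂ) ^ (1 - s) / (1 - s)
  have hR : ∀ s : ℂ, s ≠ 1 → HasDerivAt R (deriv (Z x) s - (-((x:ℂ) ^ (-s) * Real.log x)) / 2 +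
      ((-((x:ℂ) ^ (1-s) * Real.log x) * (1 - s) + (x:ℂ) ^ (1-s)) / (1-s)^2)) s := fun s hs =>
    ((hdiff x hx s hs).hasDerivAt.sub ((lerch_hasDerivAt_base x hx s).div_const 2)).add
      (lerch_hasDerivAt_base' x hx s hs)
  have hRd : DifferentiableOn ℂ R U := fun s hs =>
    (hR s (hU s hs).1).differentiableAt.differentiableWithinAt
  have hev : (fun s => ∑' n : ℕ, lerchG (n + x) s) =ᶠ[𝓝 2] R := by
    have o1 : {s : ℂ | 1 < s.re} ∈ 𝓝 (2:ℂ) :=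
      (isOpen_lt continuous_const Complex.continuous_re).mem_nhds (by simp)
    filter_upwards [o1, hUo.mem_nhds h2] with s hs hsU
    exact lerchG_hasSum x hx s hs (hU s hsU).2.2 _ (hser x hx s hs) u hu (fun n => hb n s hsU)
  have heq : Set.EqOn (fun s => ∑' n : ℕ, lerchG (n + x) s) R U :=
    (hS.analyticOnNhd hUo).eqOn_of_preconnected_of_eventuallyEq (hRd.analyticOnNhd hUo) hUp h2 hev
  have hder : deriv (fun s => ∑' n : ℕ, lerchG (n + x) s) 0 = deriv R 0 :=
    (heq.eventuallyEq_of_mem (hUo.mem_nhds h0)).deriv_eq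
  rw [hder, (hR 0 zero_ne_one).deriv] at hD
  have T := hD.tendsto_sum_nat
  have T2 : Tendsto (fun N : ℕ => ∑ n ∈ Finset.range N, deriv (lerchG (n + x)) 0) atTop
      (𝓝 (((Real.log (Real.Gamma x) - (1 / 2) * Real.log (2 * Real.pi)
        + Real.log x / 2 - (x * Real.log x - x) : ℝ)) : ℂ)) := by
    have := (((lerch_limit x hx).add_const (Real.log x / 2)).sub_const (x * Real.log x - x))
    refine ((Complex.continuous_ofReal.tendsto _).comp this).congr fun N => ?_
    simp only [Function.comp]
    rw [Finset.sum_congr rfl (fun (n : ℕ) _ => lerchG_deriv (n + x) (hpos n)), ← Complex.ofReal_sum,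
      lerch_sum_deriv x hx N]
    congr 1
    ring
  have E := tendsto_nhds_unique T T2
  simp only [neg_zero, Complex.cpow_zero, sub_zero, Complex.cpow_one, one_mul, mul_one, one_pow,
    div_one] at E
  push_cast at E ⊢
  linear_combination E
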